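/- arXiv:1711.00545 — 2 statements merged into one kernel-verified Lean document; each statement's English description precedes it below -/
import Mathlib

section
/- Let X and Y be locally compact Hausdorff spaces and let T : C_c(X,ℝ) → C_c(Y,ℝ) be a multiplicative isomorphism, i.e., a bijection satisfying T(fg) = T(f)T(g) for all f,g (pointwise products). Then there exist a homeomorphism φ : Y → X, a subset F ⊆ Y which is closed, discrete, and consists of isolated points of Y, and a continuous function p : Y∖F → (0,∞), such that for all f ∈ C_c(X,ℝ) and all y ∈ Y∖F: Tf(y) = sgn(f(φ(y)))·|f(φ(y))|^{p(y)}. -/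
open Set Topology

open Filter CompactlySupported

section Topological

variable {X : Type*} [TopologicalSpace X]

/-- An additive functional on continuous functions which is bounded above on the functions that
are small at a point is a multiple of the evaluation at that point. -/
theorem AddMonoidHom.eq_apply_one_mul_of_bounded {x : X} (L : C(X, ℝ) →+ ℝ) {ε M : ℝ} (hε : 0 < ε)
    (hL : ∀ h : C(X, ℝ), |h x| < ε → L h ≤ M) (h : C(X, ℝ)) : L h = L 1 * h x := by
  have hle : ∀ h : C(X, ℝ), h x = 0 → L h ≤ 0 := fun h hx => by
    by_contra! hpos
    obtain ⟨n, hn⟩ := exists_lt_nsmul hpos M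
    have := hL (n • h) (by simpa [hx] using hε)
    rw [map_nsmul] at this
    linarith
  have hzero : ∀ h : C(X, ℝ), h x = 0 → L h = 0 := fun h hx =>
    le_antisymm (hle h hx) (by simpa using hle (-h) (by simpa using hx))
  let c : ℝ →+ C(X, ℝ) :=
    { toFun := fun r => ContinuousMap.const X r
      map_zero' := rfl
      map_add' := fun _ _ => rfl }
  have hc : Continuous (L.comp c) := by
    refine AddMonoidHom.continuous_of_isBounded_nhds_zero (s := Metric.ball 0 ε) _
      (Metric.ball_mem_nhds _ hε) ((Metric.isBounded_Icc (-M) M).subset ?_)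
    rintro _ ⟨r, hr, rfl⟩
    have hr' : |r| < ε := by simpa using hr
    refine ⟨?_, hL _ hr'⟩
    have h1 : L (c (-r)) ≤ M := hL _ (by change |-r| < ε; rwa [abs_neg])
    rw [map_neg, map_neg] at h1
    change -M ≤ L (c r)
    linarith
  have h1 : L (c (h x)) = h x * L 1 := by
    have := map_real_smul (L.comp c) hc (h x) 1
    rw [smul_eq_mul, mul_one, smul_eq_mul] at this
    exact this
  have h2 := hzero (h - c (h x)) (sub_self (h x))
  rw [map_sub] at h2
  linarith

theorem compactlySupported_map_zero {Y : Type*} [TopologicalSpace Y] (e : C_c(X, ℝ) ≃* C_c(Y, ℝ)) :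
    e 0 = 0 := by
  simpa only [zero_mul, e.apply_symm_apply, mul_zero] using map_mul e 0 (e.symm 0)

theorem notMem_tsupport_of_mul_eq_zero {x : X} {f g : C_c(X, ℝ)} (h : f * g = 0) (hf : f x ≠ 0) :
    x ∉ tsupport g := by
  rw [notMem_tsupport_iff_eventuallyEq]
  filter_upwards [f.continuous.continuousAt.eventually_ne hf] with z hz
  exact (mul_eq_zero.1 (congrArg (fun k : C_c(X, ℝ) => k z) h)).resolve_left hz

theorem map_pos_of_local (R : C(X, ℝ) ≃* C(X, ℝ))
    (hR : ∀ x (f g : C(X, ℝ)), f =ᶠ[𝓝 x] g → R f x = R g x)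
    {f : C(X, ℝ)} {x : X} (hx : 0 < f x) : 0 < R f x := by
  let s : C(X, ℝ) := ⟨fun z => √(max (f z) (f x / 2)), by fun_prop⟩
  let t : C(X, ℝ) := ⟨fun z => (√(max (f z) (f x / 2)))⁻¹, by
    refine Continuous.inv₀ (by fun_prop) fun z => ?_
    have : 0 < max (f z) (f x / 2) := lt_max_of_lt_right (by linarith)
    exact (Real.sqrt_pos.2 this).ne'⟩
  have hst : s * t = 1 := by
    ext z
    have : 0 < max (f z) (f x / 2) := lt_max_of_lt_right (by linarith)
    exact mul_inv_cancel₀ (Real.sqrt_pos.2 this).ne'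
  have hne : R s x ≠ 0 := fun h => by
    have := congrArg (fun g => R g x) hst
    simp [h] at this
  have hs : f =ᶠ[𝓝 x] (s * s : C(X, ℝ)) := by
    have : ∀ᶠ z in 𝓝 x, f x / 2 < f z := f.continuous.continuousAt.eventually_const_lt (by linarith)
    filter_upwards [this] with z hz
    change f z = √(max (f z) (f x / 2)) * √(max (f z) (f x / 2))
    rw [max_eq_left hz.le, Real.mul_self_sqrt (by linarith)]
  rw [hR x _ _ hs, map_mul]
  exact mul_self_pos.2 hne

theorem map_ne_zero_of_local (R : C(X, ℝ) ≃* C(X, ℝ))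
    (hR : ∀ x (f g : C(X, ℝ)), f =ᶠ[𝓝 x] g → R f x = R g x)
    {f : C(X, ℝ)} {x : X} (hx : f x ≠ 0) : R f x ≠ 0 := fun h => by
  have := map_pos_of_local R hR (f := f * f) (x := x) (mul_self_pos.2 hx)
  simp [h] at this

theorem map_neg_one_of_local (R : C(X, ℝ) ≃* C(X, ℝ))
    (hR' : ∀ x (f g : C(X, ℝ)), f =ᶠ[𝓝 x] g → R.symm f x = R.symm g x) (x : X) :
    R (-1) x = -1 := by
  have hsq : ∀ z, R (-1) z * R (-1) z = 1 := fun z => by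
    rw [← ContinuousMap.mul_apply, ← map_mul]
    simp
  refine (mul_self_eq_one_iff.1 (hsq x)).resolve_left fun h1 => ?_
  have h2 : R (-1) =ᶠ[𝓝 x] (1 : C(X, ℝ)) := by
    have : ∀ᶠ z in 𝓝 x, 0 < R (-1) z :=
      (R (-1)).continuous.continuousAt.eventually_const_lt (by linarith)
    filter_upwards [this] with z hz
    exact (mul_self_eq_one_iff.1 (hsq z)).resolve_right fun h => by linarith
  have h3 := hR' x _ _ h2
  simp at h3
  norm_num at h3

/-- The logarithm of a local multiplicative automorphism, as an additive map. -/
noncomputable def logMap (R : C(X, ℝ) ≃* C(X, ℝ))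
    (hR : ∀ x (f g : C(X, ℝ)), f =ᶠ[𝓝 x] g → R f x = R g x) : C(X, ℝ) →+ C(X, ℝ) where
  toFun h := ⟨fun x => Real.log (R ⟨fun z => Real.exp (h z), by fun_prop⟩ x),
    Continuous.log (by fun_prop) fun _ => (map_pos_of_local R hR (Real.exp_pos _)).ne'⟩
  map_zero' := by
    ext x
    have : (⟨fun z => Real.exp ((0 : C(X, ℝ)) z), by fun_prop⟩ : C(X, ℝ)) = 1 := by ext; simp
    change Real.log (R _ x) = 0
    rw [this, map_one, ContinuousMap.one_apply, Real.log_one]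
  map_add' h k := by
    ext x
    have : (⟨fun z => Real.exp ((h + k) z), by fun_prop⟩ : C(X, ℝ)) =
        ⟨fun z => Real.exp (h z), by fun_prop⟩ * ⟨fun z => Real.exp (k z), by fun_prop⟩ := by
      ext
      simp [Real.exp_add]
    change Real.log (R _ x) = Real.log (R _ x) + Real.log (R _ x)
    rw [this, map_mul, ContinuousMap.mul_apply, Real.log_mul]
    · exact (map_pos_of_local R hR (Real.exp_pos _)).ne'
    · exact (map_pos_of_local R hR (Real.exp_pos _)).ne'

theorem logMap_congr (R : C(X, ℝ) ≃* C(X, ℝ))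
    (hR : ∀ x (f g : C(X, ℝ)), f =ᶠ[𝓝 x] g → R f x = R g x) (x : X) (h k : C(X, ℝ))
    (hk : h =ᶠ[𝓝 x] k) : logMap R hR h x = logMap R hR k x := by
  refine congrArg Real.log (hR x _ _ ?_)
  filter_upwards [hk] with z hz
  exact congrArg Real.exp hz

theorem map_eq_sign_mul_rpow (R : C(X, ℝ) ≃* C(X, ℝ))
    (hR : ∀ x (f g : C(X, ℝ)), f =ᶠ[𝓝 x] g → R f x = R g x)
    (hR' : ∀ x (f g : C(X, ℝ)), f =ᶠ[𝓝 x] g → R.symm f x = R.symm g x) {x : X}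
    (hx : ∀ h, logMap R hR h x = logMap R hR 1 x * h x) (f : C(X, ℝ)) :
    R f x = Real.sign (f x) * |f x| ^ logMap R hR 1 x := by
  have hpos : ∀ f : C(X, ℝ), 0 < f x → R f x = f x ^ logMap R hR 1 x := fun f hf => by
    have hm : ∀ z, 0 < max (f z) (f x / 2) := fun z => lt_max_of_lt_right (by linarith)
    let h : C(X, ℝ) := ⟨fun z => Real.log (max (f z) (f x / 2)),
      Continuous.log (by fun_prop) fun z => (hm z).ne'⟩
    have hfh : f =ᶠ[𝓝 x] (⟨fun z => Real.exp (h z), by fun_prop⟩ : C(X, ℝ)) := by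
      have : ∀ᶠ z in 𝓝 x, f x / 2 < f z :=
        f.continuous.continuousAt.eventually_const_lt (by linarith)
      filter_upwards [this] with z hz
      change f z = Real.exp (Real.log (max (f z) (f x / 2)))
      rw [Real.exp_log (hm z), max_eq_left hz.le]
    have h1 : Real.log (R f x) = logMap R hR 1 x * Real.log (f x) := by
      have h2 : h x = Real.log (f x) := by
        change Real.log (max (f x) (f x / 2)) = _
        rw [max_eq_left (by linarith)]
      rw [← h2, ← hx h, hR x _ _ hfh]
      rfl
    rw [Real.rpow_def_of_pos hf, mul_comm, ← h1, Real.exp_log (map_pos_of_local R hR hf)]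
  rcases lt_trichotomy (f x) 0 with h | h | h
  · have h1 := hpos (-1 * f) (by simpa using h)
    rw [map_mul, ContinuousMap.mul_apply, map_neg_one_of_local R hR'] at h1
    rw [Real.sign_of_neg h, abs_of_neg h]
    simp at h1
    linarith
  · have : R f x = 0 := by
      by_contra h0
      have := map_ne_zero_of_local R.symm hR' h0
      simp [h] at this
    simp [h, this]
  · rw [hpos f h, Real.sign_of_pos h, abs_of_pos h, one_mul]

theorem logMap_one_ne_zero (R : C(X, ℝ) ≃* C(X, ℝ))
    (hR : ∀ x (f g : C(X, ℝ)), f =ᶠ[𝓝 x] g → R f x = R g x)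
    (hR' : ∀ x (f g : C(X, ℝ)), f =ᶠ[𝓝 x] g → R.symm f x = R.symm g x) {x : X}
    (hx : ∀ h, logMap R hR h x = logMap R hR 1 x * h x) : logMap R hR 1 x ≠ 0 := fun h0 => by
  have h1 := map_eq_sign_mul_rpow R hR hR' hx (R.symm (ContinuousMap.const X 2))
  rw [h0, Real.rpow_zero, mul_one, R.apply_symm_apply] at h1
  change (2 : ℝ) = _ at h1
  rcases Real.sign_apply_eq (R.symm (ContinuousMap.const X 2) x) with h | h | h <;>
    rw [h] at h1 <;> norm_num at h1

end Topological

section Auxiliary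

variable {X Y : Type*} [TopologicalSpace X] [LocallyCompactSpace X] [T2Space X]
  [TopologicalSpace Y] [LocallyCompactSpace Y] [T2Space Y]

theorem exists_compactlySupported_eventuallyEq_one {x : X} {U : Set X} (hU : U ∈ 𝓝 x) :
    ∃ u : C_c(X, ℝ), u =ᶠ[𝓝 x] 1 ∧ tsupport u ⊆ U ∧ ∀ z, |u z| ≤ 1 := by
  obtain ⟨K, hK, hKU, hKc⟩ := local_compact_nhds hU
  obtain ⟨L, hL, hLK, hLc⟩ := local_compact_nhds (interior_mem_nhds.2 hK)
  obtain ⟨f, hf1, hf0, hfc, hf⟩ := exists_continuous_one_zero_of_isCompact hLc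
    isOpen_interior.isClosed_compl (disjoint_compl_right_iff_subset.2 hLK)
  refine ⟨⟨f, hfc⟩, ?_, ?_, fun z => ?_⟩
  · filter_upwards [hL] with z hz using hf1 hz
  · refine (closure_minimal (fun z hz => ?_) hKc.isClosed).trans hKU
    by_contra h
    exact hz (hf0 fun h' => h (interior_subset h'))
  · change |f z| ≤ 1
    exact abs_le.2 ⟨by linarith [(hf z).1], (hf z).2⟩

theorem Set.Infinite.exists_seq_pairwise_disjoint_isOpen {A : Set X} (hA : A.Infinite) :
    ∃ (a : ℕ → X) (W : ℕ → Set X), (∀ n, a n ∈ A) ∧ (∀ n, IsOpen (W n)) ∧ (∀ n, a n ∈ W n) ∧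
      ∀ m n, m < n → Disjoint (W m) (W n) := by
  have := hA.to_subtype
  obtain ⟨U, hUi, hUo, hUd⟩ := exists_seq_infinite_isOpen_pairwise_disjoint A
  choose V hVo hV using fun n => isOpen_induced_iff.1 (hUo n)
  choose b hb using fun n => (hUi n).nonempty
  have hbV : ∀ n, (b n : X) ∈ V n := fun n => by
    have := hb n
    rwa [← hV n] at this
  choose C hC hCc hCV using fun n => exists_mem_nhds_isClosed_subset ((hVo n).mem_nhds (hbV n))
  refine ⟨fun n => b n, fun n => interior (C n) ∩ (⋃ m ∈ Iio n, C m)ᶜ, fun n => (b n).2,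
    fun n => ?_, fun n => ⟨mem_interior_iff_mem_nhds.2 (hC n), ?_⟩, fun m n hmn => ?_⟩
  · exact isOpen_interior.inter ((finite_Iio n).isClosed_biUnion fun m _ => hCc m).isOpen_compl
  · simp only [mem_compl_iff, mem_iUnion, not_exists]
    intro m hm h
    have h' : b n ∈ U m := by
      rw [← hV m]
      exact hCV m h
    exact disjoint_left.1 (hUd (ne_of_lt hm)) h' (hb n)
  · exact disjoint_left.2 fun z hz hz' =>
      hz'.2 (mem_biUnion (show m ∈ Iio n from hmn) (interior_subset hz.1))

theorem Set.Infinite.exists_glue {A : Set X} (hA : A.Infinite) (h : X → ℕ → C(X, ℝ))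
    (hh : ∀ x ∈ A, ∀ n, |h x n x| < (1 / 2) ^ n) :
    ∃ (a : ℕ → X) (H : C(X, ℝ)), (∀ n, a n ∈ A) ∧ ∀ n, H =ᶠ[𝓝 (a n)] h (a n) n := by
  obtain ⟨a, W, ha, hWo, haW, hWd⟩ := hA.exists_seq_pairwise_disjoint_isOpen
  have hU : ∀ n, W n ∩ {z | |h (a n) n z| < (1 / 2) ^ n} ∈ 𝓝 (a n) := fun n =>
    inter_mem ((hWo n).mem_nhds (haW n))
      ((isOpen_lt (by fun_prop) continuous_const).mem_nhds (hh _ (ha n) n))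
  choose u hu1 hu2 hu3 using fun n => exists_compactlySupported_eventuallyEq_one (hU n)
  have hbound : ∀ n z, ‖u n z * h (a n) n z‖ ≤ (1 / 2 : ℝ) ^ n := fun n z => by
    rw [Real.norm_eq_abs, abs_mul]
    by_cases hz : z ∈ tsupport (u n)
    · have h1 : |h (a n) n z| < (1 / 2) ^ n := (hu2 n hz).2
      nlinarith [hu3 n z, abs_nonneg (u n z), abs_nonneg (h (a n) n z)]
    · rw [image_eq_zero_of_notMem_tsupport hz]
      simp
  refine ⟨a, ⟨fun z => ∑' n, u n z * h (a n) n z, continuous_tsum (fun n => by fun_prop)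
    summable_geometric_two hbound⟩, ha, fun n => ?_⟩
  filter_upwards [hu1 n, (hWo n).mem_nhds (haW n)] with z hz hzW
  have : ∑' m, u m z * h (a m) m z = u n z * h (a n) n z := tsum_eq_single n fun m hm => by
    have hzm : z ∉ tsupport (u m) := fun hzm => by
      rcases lt_or_gt_of_ne hm with hlt | hlt
      · exact disjoint_left.1 (hWd _ _ hlt) (hu2 m hzm).1 hzW
      · exact disjoint_left.1 (hWd _ _ hlt) hzW (hu2 m hzm).1
    rw [image_eq_zero_of_notMem_tsupport hzm, zero_mul]
  simpa [hz] using this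

/-- A point of a locally finite set `B` is isolated if membership in `B` cannot be lost in the limit
from a punctured neighborhood avoiding `B`. -/
theorem isOpen_singleton_of_finite_inter {B : Set X}
    (hB : ∀ K, IsCompact K → (B ∩ K).Finite) {x : X}
    (hx : ∀ [(𝓝[≠] x).NeBot], (∀ᶠ z in 𝓝[≠] x, z ∉ B) → x ∉ B) (hxB : x ∈ B) :
    IsOpen ({x} : Set X) := by
  by_contra hne
  have : (𝓝[≠] x).NeBot := by
    rw [neBot_iff]
    exact fun h => hne (isOpen_singleton_iff_punctured_nhds x |>.2 h)
  refine hx ?_ hxB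
  obtain ⟨K, hKc, hK⟩ := exists_compact_mem_nhds x
  have h1 := ((hB K hKc).subset sdiff_subset).isClosed.isOpen_compl.mem_nhds
    (show x ∈ ((B ∩ K) \ {x})ᶜ by simp)
  filter_upwards [mem_nhdsWithin_of_mem_nhds h1, mem_nhdsWithin_of_mem_nhds hK,
    self_mem_nhdsWithin] with z hz hzK hzx hzB
  exact hz ⟨⟨hzB, hzK⟩, hzx⟩

theorem isClosed_of_finite_inter_isCompact {B : Set X}
    (hB : ∀ K, IsCompact K → (B ∩ K).Finite) : IsClosed B := by
  rw [← isOpen_compl_iff, isOpen_iff_mem_nhds]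
  intro x hx
  obtain ⟨K, hKc, hK⟩ := exists_compact_mem_nhds x
  filter_upwards [(hB K hKc).isClosed.isOpen_compl.mem_nhds (fun h => hx h.1), hK] with z hz hzK hzB
  exact hz ⟨hzB, hzK⟩

theorem finite_nonlinear_inter_isCompact (Λ : C(X, ℝ) →+ C(X, ℝ))
    (hΛ : ∀ x (h h' : C(X, ℝ)), h =ᶠ[𝓝 x] h' → Λ h x = Λ h' x) {K : Set X} (hK : IsCompact K) :
    ({x | ∃ h, Λ h x ≠ Λ 1 x * h x} ∩ K).Finite := by
  by_contra hinf
  have hbad : ∀ x, (∃ h, Λ h x ≠ Λ 1 x * h x) → ∀ n : ℕ, ∃ h : C(X, ℝ), |h x| < (1 / 2) ^ n ∧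
      n < Λ h x := by
    rintro x ⟨h, hh⟩ n
    by_contra! hn
    let ev : C(X, ℝ) →+ ℝ :=
      { toFun := fun f => f x
        map_zero' := rfl
        map_add' := fun _ _ => rfl }
    exact hh ((ev.comp Λ).eq_apply_one_mul_of_bounded (ε := (1 / 2) ^ n) (by positivity) hn h)
  classical
  choose! h h1 h2 using hbad
  obtain ⟨a, H, ha, hH⟩ := Set.Infinite.exists_glue hinf h fun x hx n => h1 x hx.1 n
  obtain ⟨C, hC⟩ := (hK.image (Λ H).continuous).bddAbove
  obtain ⟨n, hn⟩ := exists_nat_gt C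
  have h3 := h2 _ (ha n).1 n
  rw [← hΛ _ _ _ (hH n)] at h3
  linarith [hC (mem_image_of_mem _ (ha n).2)]

theorem finite_nonpos_exponent_inter_isCompact (R : C(X, ℝ) ≃* C(X, ℝ))
    (hR : ∀ x (f g : C(X, ℝ)), f =ᶠ[𝓝 x] g → R f x = R g x)
    (hR' : ∀ x (f g : C(X, ℝ)), f =ᶠ[𝓝 x] g → R.symm f x = R.symm g x) {K : Set X}
    (hK : IsCompact K) :
    ({x | (∀ h, logMap R hR h x = logMap R hR 1 x * h x) ∧ logMap R hR 1 x ≤ 0} ∩ K).Finite := by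
  by_contra hinf
  obtain ⟨a, H, ha, hH⟩ := Set.Infinite.exists_glue hinf
    (fun _ n => ContinuousMap.const X ((1 / 2) ^ (n + 1)))
    fun x _ n => by
      rw [ContinuousMap.const_apply, abs_of_pos (by positivity)]
      exact pow_lt_pow_right_of_lt_one₀ (by norm_num) (by norm_num) n.lt_succ_self
  obtain ⟨x, -, hx⟩ := hK.exists_mapClusterPt_of_frequently (l := atTop)
    (Frequently.of_forall fun n => (ha n).2)
  have hHa : ∀ n, H (a n) = (1 / 2) ^ (n + 1) := fun n => (hH n).eq_of_nhds
  have hlim : Tendsto (fun n => H (a n)) atTop (𝓝 0) := by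
    simp_rw [hHa]
    exact (tendsto_pow_atTop_nhds_zero_of_lt_one (by norm_num) (by norm_num)).comp
      (tendsto_add_atTop_nat 1)
  have h0 : H x = 0 := by
    have h1 : MapClusterPt (H x) atTop (fun n => H (a n)) :=
      hx.continuousAt_comp H.continuous.continuousAt
    have h2 : (𝓝 (H x) ⊓ 𝓝 0).NeBot := NeBot.mono h1 (inf_le_inf_left _ hlim)
    exact eq_of_nhds_neBot h2
  have h1 : ∀ n, 1 ≤ R H (a n) := fun n => by
    have hp : 0 < H (a n) := by rw [hHa]; positivity
    rw [map_eq_sign_mul_rpow R hR hR' (ha n).1.1, Real.sign_of_pos hp, abs_of_pos hp, one_mul]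
    refine Real.one_le_rpow_of_pos_of_le_one_of_nonpos hp ?_ (ha n).1.2
    rw [hHa]
    exact pow_le_one₀ (by norm_num) (by norm_num)
  have h2 : 1 ≤ R H x := by
    by_contra! hlt
    obtain ⟨n, hn⟩ :=
      (hx.frequently ((R H).continuous.continuousAt.eventually_lt_const hlt)).exists
    linarith [h1 n]
  have h3 := map_ne_zero_of_local R.symm hR' (f := R H) (x := x) (by linarith)
  exact h3 (by simpa using h0)

theorem exists_exponent_of_local (R : C(X, ℝ) ≃* C(X, ℝ))
    (hR : ∀ x (f g : C(X, ℝ)), f =ᶠ[𝓝 x] g → R f x = R g x)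
    (hR' : ∀ x (f g : C(X, ℝ)), f =ᶠ[𝓝 x] g → R.symm f x = R.symm g x) :
    ∃ (F : Set X) (p : C(X, ℝ)), IsClosed F ∧ (∀ x ∈ F, IsOpen ({x} : Set X)) ∧
      (∀ x ∉ F, 0 < p x) ∧ ∀ f, ∀ x ∉ F, R f x = Real.sign (f x) * |f x| ^ p x := by
  let Λ := logMap R hR
  let F : Set X := {x | ∃ h, Λ h x ≠ Λ 1 x * h x} ∪
    {x | (∀ h, Λ h x = Λ 1 x * h x) ∧ Λ 1 x ≤ 0}
  have hF : ∀ x, x ∉ F ↔ (∀ h, Λ h x = Λ 1 x * h x) ∧ 0 < Λ 1 x := fun x => by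
    simp only [F, mem_union, mem_ofPred_eq, not_or, not_exists, not_and, not_not, not_le]
    exact ⟨fun h => ⟨h.1, h.2 h.1⟩, fun h => ⟨h.1, fun _ => h.2⟩⟩
  have hfin : ∀ K, IsCompact K → (F ∩ K).Finite := fun K hK => by
    rw [union_inter_distrib_right]
    exact (finite_nonlinear_inter_isCompact Λ (logMap_congr R hR) hK).union
      (finite_nonpos_exponent_inter_isCompact R hR hR' hK)
  refine ⟨F, Λ 1, isClosed_of_finite_inter_isCompact hfin,
    fun x => isOpen_singleton_of_finite_inter hfin ?_, fun x hx => ((hF x).1 hx).2,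
    fun f x hx => map_eq_sign_mul_rpow R hR hR' ((hF x).1 hx).1 f⟩
  intro _ hx
  have hcont : ∀ g : C(X, ℝ), Tendsto g (𝓝[≠] x) (𝓝 (g x)) := fun g =>
    g.continuous.continuousAt.mono_left nhdsWithin_le_nhds
  have hlin : ∀ h, Λ h x = Λ 1 x * h x := fun h =>
    tendsto_nhds_unique_of_eventuallyEq (hcont (Λ h)) (hcont (Λ 1 * h))
      (hx.mono fun z hz => ((hF z).1 hz).1 h)
  refine (hF x).2 ⟨hlin, lt_of_le_of_ne ?_ (logMap_one_ne_zero R hR hR' hlin).symm⟩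
  exact ge_of_tendsto (hcont (Λ 1)) (hx.mono fun z hz => ((hF z).1 hz).2.le)

section Corresponds

/-- The relation between points of `Y` and of `X` induced by a multiplicative isomorphism. -/
def Corresponds (e : C_c(X, ℝ) ≃* C_c(Y, ℝ)) (y : Y) (x : X) : Prop :=
  ∀ f : C_c(X, ℝ), e f y ≠ 0 → x ∈ tsupport f

variable {e : C_c(X, ℝ) ≃* C_c(Y, ℝ)} {x : X} {y : Y}

theorem exists_corresponds (e : C_c(X, ℝ) ≃* C_c(Y, ℝ)) (y : Y) : ∃ x, Corresponds e y x := by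
  obtain ⟨u, hu, -, -⟩ := exists_compactlySupported_eventuallyEq_one (univ_mem (f := 𝓝 y))
  have hu1 : u y = 1 := hu.eq_of_nhds
  let ι := {f : C_c(X, ℝ) // e f y ≠ 0}
  have : Nonempty ι := ⟨⟨e.symm u, by simp [hu1]⟩⟩
  have hne : (⋂ i : ι, tsupport i.1).Nonempty := by
    refine IsCompact.nonempty_iInter_of_directed_nonempty_isCompact_isClosed _ ?_ ?_
      (fun i => i.1.hasCompactSupport) (fun i => isClosed_tsupport _)
    · intro i j
      refine ⟨⟨i.1 * j.1, ?_⟩, ?_, ?_⟩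
      · rw [map_mul]
        exact mul_ne_zero i.2 j.2
      · exact tsupport_mul_subset_left
      · exact tsupport_mul_subset_right
    · rintro ⟨f, hf⟩
      by_contra h
      have : f = 0 := by
        ext z
        exact image_eq_zero_of_notMem_tsupport fun hz => h ⟨z, hz⟩
      rw [this, compactlySupported_map_zero] at hf
      exact hf rfl
  obtain ⟨x, hx⟩ := hne
  exact ⟨x, fun f hf => mem_iInter.1 hx ⟨f, hf⟩⟩

theorem Corresponds.map_ne_zero (h : Corresponds e y x) {u : C_c(X, ℝ)} (hu : u =ᶠ[𝓝 x] 1) :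
    e u y ≠ 0 := fun h0 => by
  obtain ⟨k, hk, hkU, -⟩ := exists_compactlySupported_eventuallyEq_one hu
  have huk : u * k = k := by
    ext z
    by_cases hz : z ∈ tsupport k
    · have : u z = 1 := hkU hz
      simp [this]
    · simp [image_eq_zero_of_notMem_tsupport hz]
  have hy : y ∉ tsupport (e k) := by
    rw [notMem_tsupport_iff_eventuallyEq]
    filter_upwards [(e u).continuous.continuousAt.eventually_ne
      (show e u y ≠ 1 by rw [h0]; exact zero_ne_one)] with z hz
    have h1 : e u z * e k z = e k z := by
      rw [← CompactlySupportedContinuousMap.mul_apply, ← map_mul, huk]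
    by_contra hne
    exact hz (mul_right_cancel₀ hne (h1.trans (one_mul _).symm))
  obtain ⟨v, hv, hvU, -⟩ := exists_compactlySupported_eventuallyEq_one
    ((isClosed_tsupport (e k)).isOpen_compl.mem_nhds hy)
  have hvk : k * e.symm v = 0 := e.injective <| by
    rw [map_mul, e.apply_symm_apply, compactlySupported_map_zero]
    ext z
    by_cases hz : z ∈ tsupport v
    · simp [image_eq_zero_of_notMem_tsupport (hvU hz)]
    · simp [image_eq_zero_of_notMem_tsupport hz]
  have hk1 : k x = 1 := hk.eq_of_nhds
  have hv1 : v y = 1 := hv.eq_of_nhds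
  exact notMem_tsupport_of_mul_eq_zero hvk (by simp [hk1]) (h _ (by simp [hv1]))

theorem Corresponds.unique {x' : X} (h : Corresponds e y x) (h' : Corresponds e y x') :
    x = x' := by
  by_contra hne
  obtain ⟨u, hu, hux, -⟩ := exists_compactlySupported_eventuallyEq_one
    (isOpen_compl_singleton.mem_nhds (show x ∈ ({x'} : Set X)ᶜ from hne))
  exact hux (h' u (h.map_ne_zero hu)) rfl

theorem Corresponds.symm (h : Corresponds e y x) : Corresponds e.symm x y := by
  intro g hg
  by_contra hy
  obtain ⟨v, hv, hvU, -⟩ := exists_compactlySupported_eventuallyEq_one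
    ((isClosed_tsupport g).isOpen_compl.mem_nhds hy)
  have hv1 : v y = 1 := hv.eq_of_nhds
  have hgv : e.symm g * e.symm v = 0 := by
    rw [← map_mul]
    convert! compactlySupported_map_zero e.symm
    ext z
    by_cases hz : z ∈ tsupport v
    · simp [image_eq_zero_of_notMem_tsupport (hvU hz)]
    · simp [image_eq_zero_of_notMem_tsupport hz]
  exact notMem_tsupport_of_mul_eq_zero hgv hg (h _ (by simp [hv1]))

theorem continuous_of_corresponds {φ : Y → X} (h : ∀ y, Corresponds e y (φ y)) :
    Continuous φ := by
  refine continuous_iff_continuousAt.2 fun y U hU => ?_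
  obtain ⟨u, hu, hux, -⟩ := exists_compactlySupported_eventuallyEq_one hU
  exact ((e u).continuous.continuousAt.eventually_ne ((h y).map_ne_zero hu)).mono
    fun z hz => hux (h z u hz)

theorem exists_homeomorph_corresponds (e : C_c(X, ℝ) ≃* C_c(Y, ℝ)) :
    ∃ φ : Y ≃ₜ X, ∀ y, Corresponds e y (φ y) := by
  choose φ hφ using exists_corresponds e
  choose ψ hψ using exists_corresponds e.symm
  exact ⟨{ toFun := φ
           invFun := ψ
           left_inv := fun y => (hψ (φ y)).unique (hφ y).symm
           right_inv := fun x => (hφ (ψ x)).unique (hψ x).symm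
           continuous_toFun := continuous_of_corresponds hφ
           continuous_invFun := continuous_of_corresponds hψ }, hφ⟩

theorem Corresponds.map_congr (h : Corresponds e y x) {f g : C_c(X, ℝ)} (hfg : f =ᶠ[𝓝 x] g) :
    e f y = e g y := by
  obtain ⟨u, hu, hux, -⟩ := exists_compactlySupported_eventuallyEq_one hfg
  have : f * u = g * u := by
    ext z
    by_cases hz : z ∈ tsupport u
    · have : f z = g z := hux hz
      simp [this]
    · simp [image_eq_zero_of_notMem_tsupport hz]
  have h1 : e f y * e u y = e g y * e u y := by
    rw [← CompactlySupportedContinuousMap.mul_apply, ← CompactlySupportedContinuousMap.mul_apply,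
      ← map_mul, ← map_mul, this]
  exact mul_right_cancel₀ (h.map_ne_zero hu) h1

end Corresponds

section Extension

/-- A compactly supported function that agrees with `f` near `x`. -/
noncomputable def truncation (x : X) (f : C(X, ℝ)) : C_c(X, ℝ) :=
  ⟨(exists_compactlySupported_eventuallyEq_one (univ_mem (f := 𝓝 x))).choose.toContinuousMap * f,
    HasCompactSupport.mul_right (CompactlySupportedContinuousMap.hasCompactSupport _)⟩

theorem truncation_eventuallyEq (x : X) (f : C(X, ℝ)) : truncation x f =ᶠ[𝓝 x] f := by
  filter_upwards [(exists_compactlySupported_eventuallyEq_one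
    (univ_mem (f := 𝓝 x))).choose_spec.1] with z hz
  exact (congrArg (· * f z) hz).trans (one_mul _)

theorem map_truncation_eventuallyEq {e : C_c(X, ℝ) ≃* C_c(Y, ℝ)} {φ : Y → X}
    (h : ∀ y, Corresponds e y (φ y)) {f : C(X, ℝ)} {g : C_c(X, ℝ)} {y : Y}
    (hfg : g =ᶠ[𝓝 (φ y)] f) : (fun z => e (truncation (φ z) f) z) =ᶠ[𝓝 y] e g := by
  filter_upwards [(continuous_of_corresponds h).continuousAt.eventually hfg.eventuallyEq_nhds]
    with z hz
  exact (h z).map_congr ((truncation_eventuallyEq _ f).trans hz.symm)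

/-- The extension of a multiplicative isomorphism to all continuous functions. -/
noncomputable def extension {e : C_c(X, ℝ) ≃* C_c(Y, ℝ)} {φ : Y → X}
    (h : ∀ y, Corresponds e y (φ y)) (f : C(X, ℝ)) : C(Y, ℝ) :=
  ⟨fun y => e (truncation (φ y) f) y, continuous_iff_continuousAt.2 fun y =>
    (e (truncation (φ y) f)).continuous.continuousAt.congr
      (map_truncation_eventuallyEq h (truncation_eventuallyEq _ f)).symm⟩

variable {e : C_c(X, ℝ) ≃* C_c(Y, ℝ)}

theorem extension_eventuallyEq {φ : Y → X}
    (h : ∀ y, Corresponds e y (φ y)) {f : C(X, ℝ)} {g : C_c(X, ℝ)} {y : Y}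
    (hfg : g =ᶠ[𝓝 (φ y)] f) : extension h f =ᶠ[𝓝 y] e g :=
  map_truncation_eventuallyEq h hfg

theorem extension_congr {φ : Y → X} (h : ∀ y, Corresponds e y (φ y)) {f g : C(X, ℝ)} {y : Y}
    (hfg : f =ᶠ[𝓝 (φ y)] g) : extension h f y = extension h g y :=
  (extension_eventuallyEq h ((truncation_eventuallyEq _ f).trans hfg)).eq_of_nhds.symm ▸ rfl

theorem extension_mul {φ : Y → X} (h : ∀ y, Corresponds e y (φ y)) (f g : C(X, ℝ)) :
    extension h (f * g) = extension h f * extension h g := by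
  ext y
  have := extension_eventuallyEq h (f := f * g) (y := y)
    (g := truncation (φ y) f * truncation (φ y) g)
    ((truncation_eventuallyEq _ f).mul (truncation_eventuallyEq _ g))
  rw [this.eq_of_nhds, map_mul]
  rfl

theorem extension_symm_extension {φ : Y → X} {ψ : X → Y} (h : ∀ y, Corresponds e y (φ y))
    (h' : ∀ x, Corresponds e.symm x (ψ x)) (hφψ : ∀ x, φ (ψ x) = x) (f : C(X, ℝ)) :
    extension h' (extension h f) = f := by
  ext x
  have h1 : truncation x f =ᶠ[𝓝 (φ (ψ x))] f := by
    rw [hφψ]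
    exact truncation_eventuallyEq x f
  rw [(extension_eventuallyEq h' (extension_eventuallyEq h h1).symm).eq_of_nhds,
    e.symm_apply_apply]
  exact (truncation_eventuallyEq x f).eq_of_nhds

/-- The local automorphism of `C(Y, ℝ)` obtained by transporting the extension along `φ`. -/
noncomputable def extensionEquiv (φ : Y ≃ₜ X) (h : ∀ y, Corresponds e y (φ y)) :
    C(Y, ℝ) ≃* C(Y, ℝ) :=
  have h' : ∀ x, Corresponds e.symm x (φ.symm x) := fun x => by
    simpa using (h (φ.symm x)).symm
  { toFun := fun f => extension h (f.comp φ.symm)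
    invFun := fun g => (extension h' g).comp φ
    left_inv := fun f => by
      change (extension h' (extension h _)).comp _ = f
      rw [extension_symm_extension h h' φ.apply_symm_apply]
      ext
      simp
    right_inv := fun g => by
      have : ((extension h' g).comp (φ : C(Y, X))).comp (φ.symm : C(X, Y)) = extension h' g := by
        ext
        simp
      change extension h (((extension h' g).comp (φ : C(Y, X))).comp (φ.symm : C(X, Y))) = g
      rw [this]
      exact extension_symm_extension (e := e.symm) h' h φ.symm_apply_apply g
    map_mul' := fun f g => extension_mul h (f.comp φ.symm) (g.comp φ.symm) }

end Extension

theorem exists_exponent_of_mulEquiv (e : C_c(X, ℝ) ≃* C_c(Y, ℝ)) :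
    ∃ (φ : Y ≃ₜ X) (F : Set Y) (p : C(Y, ℝ)), IsClosed F ∧ (∀ y ∈ F, IsOpen ({y} : Set Y)) ∧
      (∀ y ∉ F, 0 < p y) ∧
      ∀ f, ∀ y ∉ F, e f y = Real.sign (f (φ y)) * |f (φ y)| ^ p y := by
  obtain ⟨φ, h⟩ := exists_homeomorph_corresponds e
  have h' : ∀ x, Corresponds e.symm x (φ.symm x) := fun x => by
    simpa using (h (φ.symm x)).symm
  obtain ⟨F, p, hFc, hFo, hp, hF⟩ := exists_exponent_of_local (extensionEquiv φ h)
    (fun y f g hfg => extension_congr h <| by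
      have : Tendsto φ.symm (𝓝 (φ y)) (𝓝 y) := by
        simpa using φ.symm.continuous.continuousAt (x := φ y) |>.tendsto
      exact this.eventually hfg)
    (fun y f g hfg => extension_congr h' (by simpa using hfg))
  refine ⟨φ, F, p, hFc, hFo, hp, fun f y hy => ?_⟩
  have h1 : extensionEquiv φ h (f.toContinuousMap.comp φ) y = e f y :=
    (extension_eventuallyEq h (.of_forall fun z => by simp)).eq_of_nhds
  rw [← h1, hF _ y hy]
  rfl

end Auxiliary

/-- **Milgram's theorem for locally compact spaces.** A multiplicative isomorphism
`T : C_c(X,ℝ) → C_c(Y,ℝ)` is induced by a homeomorphism `φ : Y → X` and a continuous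
positive exponent `p` off a closed, discrete set `F` of isolated points:
`Tf(y) = sgn(f(φ y))·|f(φ y)|^{p(y)}` for `y ∉ F`. -/
theorem stmt_12 {X Y : Type*}
    [TopologicalSpace X] [LocallyCompactSpace X] [T2Space X]
    [TopologicalSpace Y] [LocallyCompactSpace Y] [T2Space Y]
    (T : C(X, ℝ) → C(Y, ℝ))
    (hTbij : Set.BijOn T {f | HasCompactSupport ⇑f} {g | HasCompactSupport ⇑g})
    (hTmul : ∀ f g : C(X, ℝ), HasCompactSupport ⇑f → HasCompactSupport ⇑g →
      T (f * g) = T f * T g) :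
    ∃ (φ : Y ≃ₜ X) (F : Set Y) (p : Y → ℝ),
      IsClosed F ∧ DiscreteTopology ↥F ∧ (∀ y ∈ F, IsOpen ({y} : Set Y)) ∧
      ContinuousOn p Fᶜ ∧ (∀ y ∉ F, 0 < p y) ∧
      ∀ f : C(X, ℝ), HasCompactSupport ⇑f → ∀ y ∉ F,
        T f y = Real.sign (f (φ y)) * |f (φ y)| ^ p y := by
  let T' : C_c(X, ℝ) → C_c(Y, ℝ) := fun f => ⟨T f.toContinuousMap, hTbij.mapsTo f.2⟩
  have hT' : Function.Bijective T' := by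
    refine ⟨fun f g hfg => ?_, fun g => ?_⟩
    · have h1 := hTbij.injOn f.2 g.2 (congrArg CompactlySupportedContinuousMap.toContinuousMap hfg)
      ext z
      exact DFunLike.congr_fun h1 z
    · obtain ⟨f, hf, hfg⟩ := hTbij.surjOn g.2
      exact ⟨⟨f, hf⟩, by ext z; exact DFunLike.congr_fun hfg z⟩
  let e : C_c(X, ℝ) ≃* C_c(Y, ℝ) :=
    { Equiv.ofBijective T' hT' with
      map_mul' := fun f g => by
        ext z
        exact DFunLike.congr_fun (hTmul _ _ f.2 g.2) z }
  obtain ⟨φ, F, p, hFc, hFo, hp, hF⟩ := exists_exponent_of_mulEquiv e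
  refine ⟨φ, F, p, hFc, ?_, hFo, p.continuous.continuousOn, hp, fun f hf => hF ⟨f, hf⟩⟩
  refine discreteTopology_iff_isOpen_singleton.2 fun y => ?_
  convert! (hFo y y.2).preimage (continuous_subtype_val (p := (· ∈ F)))
  ext z
  simp [Subtype.ext_iff]
end

section
/- Let X and Y be Stone spaces, i.e., compact Hausdorff zero-dimensional spaces, and let 𝕊¹ = {z ∈ ℂ : |z| = 1} be the circle group. Suppose T : C(X,𝕊¹) → C(Y,𝕊¹) is a group isomorphism (with pointwise multiplication) which is isometric for the uniform metrics: sup_{y∈Y} |Tf(y) − Tg(y)| = sup_{x∈X} |f(x) − g(x)| for all f,g ∈ C(X,𝕊¹). Then there exist a homeomorphism φ : Y → X and a continuous function p : Y → {−1,1} such that Tf(y) = f(φ(y))^{p(y)} for all f ∈ C(X,𝕊¹) and all y ∈ Y. -/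
open Set Topology

section BanachStone

variable {X Y : Type*} [TopologicalSpace X] [CompactSpace X] [TopologicalSpace Y] [CompactSpace Y]

theorem ContinuousMap.nonneg_iff_norm_smul_one_sub_le (f : C(X, ℝ)) :
    0 ≤ f ↔ ‖‖f‖ • (1 : C(X, ℝ)) - f‖ ≤ ‖f‖ := by
  rw [ContinuousMap.norm_le _ (norm_nonneg f)]
  refine ⟨fun h x => ?_, fun h x => ?_⟩
  · have h₁ := f.norm_coe_le_norm x
    have h₂ : 0 ≤ f x := h x
    rw [Real.norm_eq_abs, abs_le] at h₁ ⊢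
    simp only [ContinuousMap.sub_apply, ContinuousMap.smul_apply, ContinuousMap.one_apply,
      smul_eq_mul, mul_one]
    constructor <;> linarith
  · have h₁ := h x
    rw [Real.norm_eq_abs, abs_le] at h₁
    simp only [ContinuousMap.sub_apply, ContinuousMap.smul_apply, ContinuousMap.one_apply,
      smul_eq_mul, mul_one] at h₁
    change 0 ≤ f x
    linarith

/-- A norm-preserving linear map between spaces of continuous functions that fixes `1`
preserves and reflects the order. -/
theorem le_iff_le_of_norm_map_of_map_one (S : C(X, ℝ) →ₗ[ℝ] C(Y, ℝ)) (hS : ∀ f, ‖S f‖ = ‖f‖)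
    (h1 : S 1 = 1) (f g : C(X, ℝ)) : S f ≤ S g ↔ f ≤ g := by
  rw [← sub_nonneg, ← map_sub, ← sub_nonneg (a := g),
    ContinuousMap.nonneg_iff_norm_smul_one_sub_le, ContinuousMap.nonneg_iff_norm_smul_one_sub_le,
    hS, ← h1, ← map_smul, ← map_sub, hS]

theorem map_abs_of_norm_map_of_map_one (S : C(X, ℝ) →ₗ[ℝ] C(Y, ℝ)) (hS : ∀ f, ‖S f‖ = ‖f‖)
    (h1 : S 1 = 1) (hsurj : Function.Surjective S) (f : C(X, ℝ)) : S |f| = |S f| := by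
  have hle := le_iff_le_of_norm_map_of_map_one S hS h1
  apply le_antisymm
  · obtain ⟨h, hh⟩ := hsurj |S f|
    rw [← hh, hle, abs_le', ← hle, ← hle, map_neg, hh]
    exact ⟨le_abs_self _, neg_le_abs _⟩
  · rw [abs_le', ← map_neg, hle, hle]
    exact ⟨le_abs_self _, neg_le_abs _⟩

theorem exists_apply_eq_apply_of_norm_map_of_map_one (S : C(X, ℝ) →ₗ[ℝ] C(Y, ℝ))
    (hS : ∀ f, ‖S f‖ = ‖f‖) (h1 : S 1 = 1) (hsurj : Function.Surjective S) (y : Y) :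
    ∃ x, ∀ f, S f y = f x := by
  by_contra! hne
  choose f hf using hne
  let g : X → C(X, ℝ) := fun x => |f x - S (f x) y • 1|
  have hg0 (x : X) : S (g x) y = 0 := by
    simp [g, map_abs_of_norm_map_of_map_one S hS h1 hsurj, h1]
  have hgx (x : X) : 0 < g x x := by
    simpa [g, sub_eq_zero] using (hf x).symm
  obtain ⟨t, ht⟩ := CompactSpace.elim_nhds_subcover (fun x => {z | 0 < g x z})
    fun x => (isOpen_lt continuous_const (g x).continuous).mem_nhds (hgx x)
  have hpos (z : X) : 0 < (∑ x ∈ t, g x) z := by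
    have hz : z ∈ ⋃ x ∈ t, {z | 0 < g x z} := ht ▸ mem_univ z
    simp only [mem_iUnion, mem_ofPred_eq, exists_prop] at hz
    obtain ⟨x, hxt, hx⟩ := hz
    rw [ContinuousMap.sum_apply]
    exact Finset.sum_pos' (fun i _ => by simp [g]) ⟨x, hxt, hx⟩
  obtain ⟨ε, hε, hle⟩ := isCompact_univ.exists_forall_le'
    (∑ x ∈ t, g x).continuous.continuousOn (a := 0) fun z _ => hpos z
  have h : S (ε • 1) y ≤ S (∑ x ∈ t, g x) y :=
    (le_iff_le_of_norm_map_of_map_one S hS h1 (ε • 1) (∑ x ∈ t, g x)).2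
      (fun z => by simpa using hle z (mem_univ z)) y
  rw [map_smul, h1, map_sum, ContinuousMap.sum_apply, Finset.sum_eq_zero fun x _ => hg0 x] at h
  simp at h
  linarith

theorem abs_map_one_eq_one (S : C(X, ℝ) →ₗ[ℝ] C(Y, ℝ))
    (hS : ∀ f, ‖S f‖ = ‖f‖) (hsurj : Function.Surjective S) : |S 1| = 1 := by
  have hone : ‖(1 : C(X, ℝ))‖ ≤ 1 := (ContinuousMap.norm_le _ zero_le_one).2 fun x => by simp
  have hle (y : Y) : |S 1 y| ≤ 1 := ((S 1).norm_coe_le_norm y).trans ((hS 1).trans_le hone)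
  obtain ⟨k, hk⟩ := hsurj (1 - |S 1|)
  have hky (y : Y) : S k y = 1 - |S 1 y| := by rw [hk]; rfl
  have hadd : ‖1 + k‖ ≤ 1 := by
    rw [← hS, map_add, ContinuousMap.norm_le _ zero_le_one]
    intro y
    rw [ContinuousMap.add_apply, hky, Real.norm_eq_abs]
    grind
  have hsub : ‖1 - k‖ ≤ 1 := by
    rw [← hS, map_sub, ContinuousMap.norm_le _ zero_le_one]
    intro y
    rw [ContinuousMap.sub_apply, hky, Real.norm_eq_abs]
    grind
  have hk0 : k = 0 := by
    ext x
    have h₁ := (le_abs_self _).trans (((1 + k).norm_coe_le_norm x).trans hadd)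
    have h₂ := (le_abs_self _).trans (((1 - k).norm_coe_le_norm x).trans hsub)
    simp only [ContinuousMap.add_apply, ContinuousMap.sub_apply, ContinuousMap.one_apply,
      ContinuousMap.zero_apply] at h₁ h₂ ⊢
    linarith
  rw [hk0, map_zero] at hk
  exact (sub_eq_zero.1 hk.symm).symm

variable [T2Space X] [T2Space Y]

theorem exists_homeomorph_of_norm_map_of_map_one (S : C(X, ℝ) →ₗ[ℝ] C(Y, ℝ))
    (hS : ∀ f, ‖S f‖ = ‖f‖) (h1 : S 1 = 1) (hsurj : Function.Surjective S) :
    ∃ φ : Y ≃ₜ X, ∀ f y, S f y = f (φ y) := by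
  choose φ hφ using exists_apply_eq_apply_of_norm_map_of_map_one S hS h1 hsurj
  have hcont : Continuous φ := by
    refine continuous_iff_isClosed.2 fun K hK => isOpen_compl_iff.1 (isOpen_iff_mem_nhds.2 ?_)
    intro y hy
    obtain ⟨f, hf0, hf1, -⟩ := exists_continuous_zero_one_of_isClosed hK
      (isClosed_singleton (x := φ y)) (disjoint_singleton_right.2 hy)
    filter_upwards [(isOpen_lt continuous_const (S f).continuous).mem_nhds
      (show (0 : ℝ) < S f y by simp [hφ, hf1 (mem_singleton _)])] with z hz hzK
    simp [hφ, hf0 hzK] at hz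
  have hinj : Function.Injective φ := by
    intro y z hyz
    by_contra hne
    obtain ⟨k, hk0, hk1, -⟩ := exists_continuous_zero_one_of_isClosed
      (isClosed_singleton (x := y)) (isClosed_singleton (x := z))
      (disjoint_singleton.2 hne)
    obtain ⟨f, rfl⟩ := hsurj k
    have h0 := hk0 (mem_singleton y)
    have h1 := hk1 (mem_singleton z)
    rw [hφ] at h0 h1
    rw [hyz, h1] at h0
    simp at h0
  have hsur : Function.Surjective φ := by
    intro x
    by_contra hx
    obtain ⟨f, hf0, hf1, -⟩ := exists_continuous_zero_one_of_isClosed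
      (isCompact_range hcont).isClosed (isClosed_singleton (x := x))
      (disjoint_singleton_right.2 hx)
    have hSf : S f = 0 := by
      ext y
      simp [hφ, hf0 (mem_range_self y)]
    have hf : f = 0 := norm_eq_zero.1 (by rw [← hS, hSf, norm_zero])
    simpa [hf] using hf1 (mem_singleton x)
  exact ⟨(Continuous.homeoOfEquivCompactToT2 (f := Equiv.ofBijective φ ⟨hinj, hsur⟩) hcont),
    fun f y => hφ y f⟩

/-- **Banach–Stone theorem**, for real-valued functions. -/
theorem exists_homeomorph_of_norm_map (S : C(X, ℝ) →ₗ[ℝ] C(Y, ℝ))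
    (hS : ∀ f, ‖S f‖ = ‖f‖) (hsurj : Function.Surjective S) :
    ∃ φ : Y ≃ₜ X, (∀ y, |S 1 y| = 1) ∧ ∀ f y, S f y = S 1 y * f (φ y) := by
  have habs (y : Y) : |S 1 y| = 1 := DFunLike.congr_fun (abs_map_one_eq_one S hS hsurj) y
  have hsq : S 1 * S 1 = 1 := by
    ext y
    simp [← abs_mul_abs_self (S 1 y), habs]
  obtain ⟨φ, hφ⟩ := exists_homeomorph_of_norm_map_of_map_one
    ((LinearMap.mulLeft ℝ (S 1)).comp S)
    (fun f => by
      rw [← hS f]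
      refine le_antisymm ?_ ?_ <;> refine (ContinuousMap.norm_le _ (norm_nonneg _)).2 fun y => ?_
      · simpa [habs] using (S f).norm_coe_le_norm y
      · simpa [habs] using (S 1 * S f).norm_coe_le_norm y)
    (by simpa using hsq)
    (fun g => by
      obtain ⟨f, hf⟩ := hsurj (S 1 * g)
      exact ⟨f, by simp [hf, ← mul_assoc, hsq]⟩)
  refine ⟨φ, habs, fun f y => ?_⟩
  rw [← hφ]
  have := DFunLike.congr_fun hsq y
  simp only [ContinuousMap.mul_apply, ContinuousMap.one_apply] at this
  simp [← mul_assoc, this]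

end BanachStone

section Circle

variable {X Y : Type*} [TopologicalSpace X] [TopologicalSpace Y]

theorem Circle.norm_exp_sub_one_le_iff {s r : ℝ} (hs : |s| ≤ Real.pi) (hr₀ : 0 ≤ r)
    (hr : r ≤ Real.pi) : ‖(Circle.exp s : ℂ) - 1‖ ≤ 2 * Real.sin (r / 2) ↔ |s| ≤ r := by
  have habs : |Real.sin (s / 2)| = Real.sin (|s| / 2) := by
    rw [Real.abs_sin_eq_sin_abs_of_abs_le_pi
      (by rw [abs_div, abs_two]; linarith [abs_nonneg s]), abs_div, abs_two]
  rw [Circle.coe_exp, mul_comm, Complex.norm_exp_I_mul_ofReal_sub_one, Real.norm_eq_abs, abs_mul,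
    abs_two, habs, mul_le_mul_iff_right₀ two_pos,
    Real.strictMonoOn_sin.le_iff_le ⟨by linarith [abs_nonneg s], by linarith⟩
      ⟨by linarith, by linarith⟩]
  constructor <;> intro h <;> linarith

theorem Circle.mem_slitPlane_of_ne_neg_one {z : Circle} (hz : z ≠ -1) :
    (z : ℂ) ∈ Complex.slitPlane := by
  rw [Complex.mem_slitPlane_iff_arg]
  refine ⟨fun h => hz ?_, z.coe_ne_zero⟩
  rw [← Circle.exp_arg z, h]
  ext
  simp

theorem Circle.continuousAt_arg {z : Circle} (hz : z ≠ -1) :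
    ContinuousAt (fun w : Circle => Complex.arg w) z :=
  (Complex.continuousAt_arg (Circle.mem_slitPlane_of_ne_neg_one hz)).comp
    continuous_subtype_val.continuousAt

/-- Circle-valued functions on a compact totally disconnected space lift along `Circle.exp`. -/
theorem exists_circle_exp_comp_eq [CompactSpace X] [T2Space X] [TotallyDisconnectedSpace X]
    (f : C(X, Circle)) : ∃ u : C(X, ℝ), Circle.exp.comp u = f := by
  classical
  obtain ⟨C, hC, hC₁, hC₂⟩ := exists_clopen_of_closed_subset_open
    (isClosed_singleton.preimage f.continuous : IsClosed (f ⁻¹' {1}))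
    (isOpen_compl_singleton.preimage f.continuous : IsOpen (f ⁻¹' {-1}ᶜ))
    (by
      intro x hx
      simp only [mem_preimage, mem_singleton_iff] at hx
      simp [hx, Circle.ext_iff]
      norm_num)
  let u : X → ℝ := fun x =>
    if x ∈ C then Complex.arg (f x) else Real.pi + Complex.arg (-f x : Circle)
  have hu : Continuous u := by
    refine continuous_iff_continuousAt.2 fun x => ?_
    by_cases hx : x ∈ C
    · refine ContinuousAt.congr (f := fun x => Complex.arg (f x)) ?_ ?_
      · exact ContinuousAt.comp (g := fun w : Circle => Complex.arg w)
          (Circle.continuousAt_arg (hC₂ hx)) f.continuous.continuousAt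
      · filter_upwards [hC.isOpen.mem_nhds hx] with z hz
        simp [u, hz]
    · refine ContinuousAt.congr (f := fun x => Real.pi + Complex.arg (-f x : Circle)) ?_ ?_
      · refine continuousAt_const.add ?_
        refine ContinuousAt.comp (g := fun w : Circle => Complex.arg w)
          (Circle.continuousAt_arg ?_) f.continuous.neg.continuousAt
        exact fun h => hx (hC₁ (neg_injective h))
      · filter_upwards [hC.compl.isOpen.mem_nhds hx] with z hz
        simp only [u, if_neg hz]
  refine ⟨⟨u, hu⟩, ContinuousMap.ext fun x => ?_⟩
  change Circle.exp (u x) = f x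
  by_cases hx : x ∈ C
  · simp [u, hx]
  · simp only [u, if_neg hx, Circle.exp_add, Circle.exp_arg]
    ext
    simp

theorem exp_comp_add (u v : C(X, ℝ)) :
    Circle.exp.comp (u + v) = Circle.exp.comp u * Circle.exp.comp v := by
  ext x
  simp

theorem exp_comp_nsmul (n : ℕ) (u : C(X, ℝ)) :
    Circle.exp.comp ((n : ℝ) • u) = Circle.exp.comp u ^ n := by
  ext x
  simp

theorem eq_of_exp_comp_inv_smul_eq {u v : C(X, ℝ)}
    (h : ∀ n : ℕ, n ≠ 0 → Circle.exp.comp ((n : ℝ)⁻¹ • u) = Circle.exp.comp ((n : ℝ)⁻¹ • v)) :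
    u = v := by
  ext x
  obtain ⟨n, hn⟩ := exists_nat_gt (max 1 (max |u x| |v x|))
  rw [max_lt_iff, max_lt_iff] at hn
  obtain ⟨hn₁, hu, hv⟩ := hn
  have hn₀ : (0 : ℝ) < n := by linarith
  have hx : Circle.exp ((n : ℝ)⁻¹ * u x) = Circle.exp ((n : ℝ)⁻¹ * v x) :=
    DFunLike.congr_fun (h n (by rintro rfl; simp at hn₀)) x
  have key (s : ℝ) (hs : |s| < n) : (n : ℝ)⁻¹ * s ∈ Icc (-1 : ℝ) 1 := by
    rw [mem_Icc, ← abs_le, abs_mul, abs_inv, Nat.abs_cast, inv_mul_le_one₀ hn₀]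
    exact hs.le
  have := Circle.exp_injOn_Icc (by linarith [Real.pi_gt_three]) (key _ hu) (key _ hv) hx
  exact mul_left_cancel₀ (inv_ne_zero hn₀.ne') this

theorem forall_norm_sub_le_iff_iSup_le [CompactSpace X] (f g : C(X, Circle)) {c : ℝ} (hc : 0 ≤ c) :
    (∀ x, ‖(f x : ℂ) - g x‖ ≤ c) ↔ (⨆ x, ‖(f x : ℂ) - g x‖) ≤ c := by
  refine ⟨fun h => Real.iSup_le h hc, fun h x => le_trans ?_ h⟩
  refine le_ciSup (f := fun x => ‖(f x : ℂ) - g x‖) ⟨2, ?_⟩ x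
  rintro _ ⟨x, rfl⟩
  refine (norm_sub_le _ _).trans ?_
  simp only [Circle.norm_coe]
  norm_num

/-- Circle-valued functions at uniform angular distance less than `π` from `1` have a
continuous argument. -/
theorem exists_exp_comp_eq_of_abs_arg_le (f : C(X, Circle)) {r : ℝ} (hr : r < Real.pi)
    (hf : ∀ x, |Complex.arg (f x)| ≤ r) :
    ∃ u : C(X, ℝ), (∀ x, |u x| ≤ r) ∧ Circle.exp.comp u = f := by
  refine ⟨⟨fun x => Complex.arg (f x), continuous_iff_continuousAt.2 fun x => ?_⟩, hf,
    ContinuousMap.ext fun x => Circle.exp_arg (f x)⟩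
  refine ContinuousAt.comp (g := fun w : Circle => Complex.arg w)
    (Circle.continuousAt_arg fun h => ?_) f.continuous.continuousAt
  have := hf x
  rw [h] at this
  simp [Complex.arg_neg_one, abs_of_pos Real.pi_pos] at this
  linarith

/-- `T` maps the sequence `exp (i u / n)`, `n ≥ 1`, to the sequence `exp (i v / n)`. -/
def IsLogOf (T : C(X, Circle) ≃* C(Y, Circle)) (u : C(X, ℝ)) (v : C(Y, ℝ)) : Prop :=
  ∀ n : ℕ, n ≠ 0 → T (Circle.exp.comp ((n : ℝ)⁻¹ • u)) = Circle.exp.comp ((n : ℝ)⁻¹ • v)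

theorem IsLogOf.add {T : C(X, Circle) ≃* C(Y, Circle)} {u u' : C(X, ℝ)} {v v' : C(Y, ℝ)}
    (h : IsLogOf T u v) (h' : IsLogOf T u' v') : IsLogOf T (u + u') (v + v') := by
  intro n hn
  rw [smul_add, exp_comp_add, map_mul, h n hn, h' n hn, smul_add, exp_comp_add]

theorem IsLogOf.symm {T : C(X, Circle) ≃* C(Y, Circle)} {u : C(X, ℝ)} {v : C(Y, ℝ)}
    (h : IsLogOf T u v) : IsLogOf T.symm v u := fun n hn => by
  rw [← h n hn, T.symm_apply_apply]

theorem IsLogOf.unique {T : C(X, Circle) ≃* C(Y, Circle)} {u : C(X, ℝ)} {v v' : C(Y, ℝ)}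
    (h : IsLogOf T u v) (h' : IsLogOf T u v') : v = v' :=
  eq_of_exp_comp_inv_smul_eq fun n hn => by rw [← h n hn, h' n hn]

variable [CompactSpace X] [CompactSpace Y]

theorem abs_arg_le_iff_of_isometry (T : C(X, Circle) ≃* C(Y, Circle))
    (hT : ∀ f g : C(X, Circle),
      (⨆ y : Y, ‖(T f y : ℂ) - (T g y : ℂ)‖) = ⨆ x : X, ‖(f x : ℂ) - (g x : ℂ)‖)
    (f : C(X, Circle)) {r : ℝ} (hr₀ : 0 ≤ r) (hr : r ≤ Real.pi) :
    (∀ y, |Complex.arg (T f y)| ≤ r) ↔ ∀ x, |Complex.arg (f x)| ≤ r := by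
  have hc : 0 ≤ 2 * Real.sin (r / 2) :=
    mul_nonneg zero_le_two (Real.sin_nonneg_of_nonneg_of_le_pi (by linarith) (by linarith))
  have key (z : Circle) : |Complex.arg z| ≤ r ↔ ‖(z : ℂ) - (1 : Circle)‖ ≤ 2 * Real.sin (r / 2) := by
    rw [← Circle.norm_exp_sub_one_le_iff (Complex.abs_arg_le_pi z) hr₀ hr, Circle.exp_arg,
      Circle.coe_one]
  simp only [key]
  have hY := forall_norm_sub_le_iff_iSup_le (T f) (T 1) hc
  rw [hT, ← forall_norm_sub_le_iff_iSup_le f 1 hc, map_one] at hY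
  exact hY

theorem abs_inv_mul_le_iff {n s r : ℝ} (hn : 0 < n) : |n⁻¹ * s| ≤ n⁻¹ * r ↔ |s| ≤ r := by
  rw [abs_mul, abs_of_pos (inv_pos.2 hn), mul_le_mul_iff_right₀ (inv_pos.2 hn)]

theorem arg_exp_of_abs_le {s r : ℝ} (hs : |s| ≤ r) (hr : r < Real.pi) :
    Complex.arg (Circle.exp s) = s :=
  Circle.arg_exp (by linarith [(abs_le.1 hs).1]) (by linarith [(abs_le.1 hs).2])

theorem exists_map_exp_comp_eq (T : C(X, Circle) ≃* C(Y, Circle))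
    (hT : ∀ f g : C(X, Circle),
      (⨆ y : Y, ‖(T f y : ℂ) - (T g y : ℂ)‖) = ⨆ x : X, ‖(f x : ℂ) - (g x : ℂ)‖)
    {u : C(X, ℝ)} {r : ℝ} (hr₀ : 0 ≤ r) (hr : r < Real.pi)
    (hu : ∀ x, |u x| ≤ r) :
    ∃ v : C(Y, ℝ), (∀ y, |v y| ≤ r) ∧ T (Circle.exp.comp u) = Circle.exp.comp v := by
  obtain ⟨v, hv, h⟩ := exists_exp_comp_eq_of_abs_arg_le (T (Circle.exp.comp u)) hr
    ((abs_arg_le_iff_of_isometry T hT _ hr₀ hr.le).2 fun x => by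
      rw [ContinuousMap.comp_apply, arg_exp_of_abs_le (hu x) hr]
      exact hu x)
  exact ⟨v, hv, h.symm⟩

theorem exists_isLogOf (T : C(X, Circle) ≃* C(Y, Circle))
    (hT : ∀ f g : C(X, Circle),
      (⨆ y : Y, ‖(T f y : ℂ) - (T g y : ℂ)‖) = ⨆ x : X, ‖(f x : ℂ) - (g x : ℂ)‖)
    (u : C(X, ℝ)) : ∃ v, IsLogOf T u v := by
  have hpi := Real.pi_gt_three
  obtain ⟨N, hN⟩ := exists_nat_gt ‖u‖
  have hN₀ : (0 : ℝ) < N := (norm_nonneg u).trans_lt hN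
  have key (n : ℕ) (hn : n ≠ 0) : ∃ w : C(Y, ℝ), (∀ y, |w y| ≤ (n : ℝ)⁻¹) ∧
      T (Circle.exp.comp ((n : ℝ)⁻¹ • (N : ℝ)⁻¹ • u)) = Circle.exp.comp w := by
    have hn₁ : (1 : ℝ) ≤ n := by exact_mod_cast Nat.one_le_iff_ne_zero.2 hn
    refine exists_map_exp_comp_eq T hT (by positivity)
      ((inv_le_one_of_one_le₀ hn₁).trans_lt (by linarith)) fun x => ?_
    rw [ContinuousMap.smul_apply, smul_eq_mul, ← mul_one (n : ℝ)⁻¹, mul_assoc,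
      abs_inv_mul_le_iff (by linarith), one_mul, ContinuousMap.smul_apply, smul_eq_mul, abs_mul,
      abs_inv, Nat.abs_cast, inv_mul_le_one₀ hN₀]
    exact (u.norm_coe_le_norm x).trans hN.le
  obtain ⟨w₁, hw₁, hTw₁⟩ := key 1 one_ne_zero
  refine ⟨(N : ℝ) • w₁, fun n hn => ?_⟩
  have hn₀ : (n : ℝ) ≠ 0 := Nat.cast_ne_zero.2 hn
  obtain ⟨w, hw, hTw⟩ := key n hn
  have hw₁w : w₁ = (n : ℝ) • w := by
    ext y
    refine Circle.exp_injOn_Icc (a := -1) (b := 1) (by linarith) (abs_le.1 (by simpa using hw₁ y))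
      (abs_le.1 ?_) ?_
    · rw [ContinuousMap.smul_apply, smul_eq_mul, abs_mul, Nat.abs_cast]
      calc (n : ℝ) * |w y| ≤ n * (n : ℝ)⁻¹ := by gcongr; exact hw y
        _ = 1 := mul_inv_cancel₀ hn₀
    · refine DFunLike.congr_fun (f := Circle.exp.comp w₁) (g := Circle.exp.comp ((n : ℝ) • w)) ?_ y
      rw [exp_comp_nsmul, ← hTw, ← map_pow, ← exp_comp_nsmul, smul_inv_smul₀ hn₀, ← hTw₁]
      simp
  calc T (Circle.exp.comp ((n : ℝ)⁻¹ • u))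
      = T (Circle.exp.comp ((n : ℝ)⁻¹ • (N : ℝ)⁻¹ • u)) ^ N := by
        rw [← map_pow, ← exp_comp_nsmul, smul_comm (N : ℝ), smul_inv_smul₀ hN₀.ne']
    _ = Circle.exp.comp ((n : ℝ)⁻¹ • (N : ℝ) • w₁) := by
        rw [hTw, ← exp_comp_nsmul, hw₁w, smul_comm (N : ℝ), inv_smul_smul₀ hn₀]

theorem IsLogOf.norm_le (T : C(X, Circle) ≃* C(Y, Circle))
    (hT : ∀ f g : C(X, Circle),
      (⨆ y : Y, ‖(T f y : ℂ) - (T g y : ℂ)‖) = ⨆ x : X, ‖(f x : ℂ) - (g x : ℂ)‖)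
    {u : C(X, ℝ)} {v : C(Y, ℝ)} (h : IsLogOf T u v) : ‖v‖ ≤ ‖u‖ := by
  have hpi := Real.pi_gt_three
  obtain ⟨n, hn⟩ := exists_nat_gt (max ‖u‖ ‖v‖)
  rw [max_lt_iff] at hn
  have hn₀ : (0 : ℝ) < n := (norm_nonneg u).trans_lt hn.1
  have small {s : ℝ} (hs : s < n) : (n : ℝ)⁻¹ * s < Real.pi := by
    have : (n : ℝ)⁻¹ * s < 1 := (inv_mul_lt_one₀ hn₀).2 hs
    linarith
  have hu (x : X) : |(n : ℝ)⁻¹ * u x| ≤ (n : ℝ)⁻¹ * ‖u‖ :=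
    (abs_inv_mul_le_iff hn₀).2 (u.norm_coe_le_norm x)
  have hv (y : Y) : |(n : ℝ)⁻¹ * v y| ≤ (n : ℝ)⁻¹ * ‖v‖ :=
    (abs_inv_mul_le_iff hn₀).2 (v.norm_coe_le_norm y)
  have key := (abs_arg_le_iff_of_isometry T hT (Circle.exp.comp ((n : ℝ)⁻¹ • u))
    (r := (n : ℝ)⁻¹ * ‖u‖) (by positivity) (small hn.1).le).2 fun x => by
      rw [ContinuousMap.comp_apply, ContinuousMap.smul_apply, smul_eq_mul,
        arg_exp_of_abs_le (hu x) (small hn.1)]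
      exact hu x
  rw [h n (by rintro rfl; simp at hn₀)] at key
  refine (ContinuousMap.norm_le _ (norm_nonneg u)).2 fun y => ?_
  have := key y
  rwa [ContinuousMap.comp_apply, ContinuousMap.smul_apply, smul_eq_mul,
    arg_exp_of_abs_le (hv y) (small hn.2), abs_inv_mul_le_iff hn₀] at this

/-- An isometric group isomorphism between groups of circle-valued functions is induced, through
the exponential, by a surjective linear isometry between the spaces of real-valued functions. -/
theorem exists_linearMap_map_exp_comp_eq (T : C(X, Circle) ≃* C(Y, Circle))
    (hT : ∀ f g : C(X, Circle),
      (⨆ y : Y, ‖(T f y : ℂ) - (T g y : ℂ)‖) = ⨆ x : X, ‖(f x : ℂ) - (g x : ℂ)‖) :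
    ∃ S : C(X, ℝ) →ₗ[ℝ] C(Y, ℝ), (∀ u, ‖S u‖ = ‖u‖) ∧
      Function.Surjective S ∧ ∀ u, T (Circle.exp.comp u) = Circle.exp.comp (S u) := by
  have hT' (f g : C(Y, Circle)) :
      (⨆ x : X, ‖(T.symm f x : ℂ) - (T.symm g x : ℂ)‖) = ⨆ y : Y, ‖(f y : ℂ) - (g y : ℂ)‖ := by
    rw [← hT, T.apply_symm_apply, T.apply_symm_apply]
  choose S hS using exists_isLogOf T hT
  have hnorm (u : C(X, ℝ)) : ‖S u‖ = ‖u‖ :=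
    le_antisymm ((hS u).norm_le T hT) ((hS u).symm.norm_le T.symm hT')
  let A : C(X, ℝ) →+ C(Y, ℝ) := AddMonoidHom.mk' S fun u v => (hS (u + v)).unique ((hS u).add (hS v))
  have hA : Continuous A := (AddMonoidHomClass.isometry_of_norm A hnorm).continuous
  refine ⟨(A.toRealLinearMap hA : C(X, ℝ) →ₗ[ℝ] C(Y, ℝ)), hnorm, fun v => ?_, fun u => ?_⟩
  · obtain ⟨u, hu⟩ := exists_isLogOf T.symm hT' v
    exact ⟨u, (hS u).unique hu.symm⟩
  · have := hS u 1 one_ne_zero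
    rwa [Nat.cast_one, inv_one, one_smul, one_smul] at this

end Circle

/-- Isometric group isomorphisms between groups of circle-valued continuous functions on
Stone spaces: if `T : C(X,𝕊¹) → C(Y,𝕊¹)` is a group isomorphism which is isometric for the
uniform metrics, then `Tf(y) = f(φ(y))^{p(y)}` for a homeomorphism `φ : Y → X` and a
continuous `p : Y → {−1,1}`. -/
theorem stmt_19 {X Y : Type*}
    [TopologicalSpace X] [CompactSpace X] [T2Space X]
    [TopologicalSpace Y] [CompactSpace Y] [T2Space Y]
    -- `X` and `Y` are zero-dimensional: the clopen sets form a basis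
    (hX : TopologicalSpace.IsTopologicalBasis {s : Set X | IsClopen s})
    (hY : TopologicalSpace.IsTopologicalBasis {s : Set Y | IsClopen s})
    (T : C(X, Circle) → C(Y, Circle))
    (hTbij : Function.Bijective T)
    (hTmul : ∀ f g : C(X, Circle), T (f * g) = T f * T g)
    (hTiso : ∀ f g : C(X, Circle),
      (⨆ y : Y, ‖(T f y : ℂ) - (T g y : ℂ)‖) = ⨆ x : X, ‖(f x : ℂ) - (g x : ℂ)‖) :
    ∃ (φ : Y ≃ₜ X) (p : Y → ℤ), Continuous p ∧ (∀ y, p y = 1 ∨ p y = -1) ∧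
      ∀ (f : C(X, Circle)) (y : Y), T f y = f (φ y) ^ p y := by
  have := totallySeparatedSpace_of_t0_of_basis_clopen hX
  obtain ⟨S, hS, hsurj, hexp⟩ := exists_linearMap_map_exp_comp_eq
    (MulEquiv.mk (Equiv.ofBijective T hTbij) hTmul) hTiso
  obtain ⟨φ, habs, hφ⟩ := exists_homeomorph_of_norm_map S hS hsurj
  have hint (y : Y) : ∃ k : ℤ, (k = 1 ∨ k = -1) ∧ (k : ℝ) = S 1 y := by
    rcases eq_or_eq_neg_of_abs_eq (habs y) with h | h
    · exact ⟨1, by simp, by simp [h]⟩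
    · exact ⟨-1, by simp, by simp [h]⟩
  choose p hp hpS using hint
  refine ⟨φ, p, ?_, hp, fun f y => ?_⟩
  · rw [Int.isClosedEmbedding_coe_real.continuous_iff]
    exact (S 1).continuous.congr fun y => (hpS y).symm
  · obtain ⟨u, rfl⟩ := exists_circle_exp_comp_eq f
    calc T (Circle.exp.comp u) y = Circle.exp (S u y) := DFunLike.congr_fun (hexp u) y
      _ = Circle.exp (u (φ y)) ^ p y := by rw [hφ, ← hpS, Circle.exp_intCast_mul]
end
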